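/- Let m be a positive odd integer, a = (0,…,0) and b = (1,…,1) in ℤ_2^d, and for λ an eigenvalue of H_m let E_λ be the orthogonal projection onto ker(H_m − λI); set Λ_{ab}^+ = {λ : E_λ e_a = E_λ e_b ≠ 0} and Λ_{ab}^− = {λ : E_λ e_a = −E_λ e_b ≠ 0}. If d is even, then for every λ, λ ∈ Λ_{ab}^+ iff −λ ∈ Λ_{ab}^+, and λ ∈ Λ_{ab}^− iff −λ ∈ Λ_{ab}^−. If d is odd, then λ ∈ Λ_{ab}^+ iff −λ ∈ Λ_{ab}^−, and λ ∈ Λ_{ab}^− iff −λ ∈ Λ_{ab}^+. -/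

import Mathlib

open Matrix

/-- The real symmetric matrix `H_m` indexed by `ℤ_2^d`: entry `m` when `u - v = e_0`,
entry `2` when `u - v = e_j` for some `j ≠ 0`, and `0` otherwise. -/
noncomputable def Hm (d m : ℕ) [NeZero d] :
    Matrix (Fin d → ZMod 2) (Fin d → ZMod 2) ℝ :=
  Matrix.of fun u v =>
    if u - v = Pi.single (0 : Fin d) 1 then (m : ℝ)
    else if ∃ j : Fin d, j ≠ 0 ∧ u - v = Pi.single j 1 then 2 else 0

/-- The Hamming weight of `g ∈ ℤ_2^d`. -/
def wt {d : ℕ} (g : Fin d → ZMod 2) : ℕ := (Finset.univ.filter fun j => g j ≠ 0).card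

/-- The character vector `ψ_g(x) = (-1)^{⟨g,x⟩}` of `ℤ_2^d`. -/
def psi {d : ℕ} (g : Fin d → ZMod 2) : (Fin d → ZMod 2) → ℝ :=
  fun x => (-1 : ℝ) ^ (∑ j, (g j).val * (x j).val)

/-- `E` is the orthogonal projection onto `ker(M - μ I)`: `E` is symmetric, idempotent,
its range is contained in the eigenspace, and it fixes the eigenspace. -/
def IsEigenprojR {n : Type*} [Fintype n] (M : Matrix n n ℝ) (μ : ℝ) (E : Matrix n n ℝ) :
    Prop :=
  E.IsHermitian ∧ E * E = E ∧ M * E = μ • E ∧ ∀ v : n → ℝ, M *ᵥ v = μ • v → E *ᵥ v = v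
/-- `λ` belongs to the plus set `Λ_{ab}^+`: `E_λ e_a = E_λ e_b ≠ 0`, where `a = (0,…,0)`
and `b = (1,…,1)` in `ℤ_2^d`. -/
def InPlusSet (d : ℕ) (E : ℝ → Matrix (Fin d → ZMod 2) (Fin d → ZMod 2) ℝ)
    (lam : ℝ) : Prop :=
  E lam *ᵥ Pi.single (0 : Fin d → ZMod 2) 1 = E lam *ᵥ Pi.single (1 : Fin d → ZMod 2) 1
    ∧ E lam *ᵥ Pi.single (0 : Fin d → ZMod 2) 1 ≠ 0

/-- `λ` belongs to the minus set `Λ_{ab}^-`: `E_λ e_a = -E_λ e_b ≠ 0`, where `a = (0,…,0)`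
and `b = (1,…,1)` in `ℤ_2^d`. -/
def InMinusSet (d : ℕ) (E : ℝ → Matrix (Fin d → ZMod 2) (Fin d → ZMod 2) ℝ)
    (lam : ℝ) : Prop :=
  E lam *ᵥ Pi.single (0 : Fin d → ZMod 2) 1 = -(E lam *ᵥ Pi.single (1 : Fin d → ZMod 2) 1)
    ∧ E lam *ᵥ Pi.single (0 : Fin d → ZMod 2) 1 ≠ 0

/-- the sign character of `ZMod 2`. -/
noncomputable def chi2 (x : ZMod 2) : ℝ := if x = 0 then 1 else -1

lemma chi2_add (x y : ZMod 2) : chi2 (x + y) = chi2 x * chi2 y := by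
  have h : (x = 0 ∨ x = 1) ∧ (y = 0 ∨ y = 1) := by
    revert x y; decide
  have h11 : (1 + 1 : ZMod 2) = 0 := by decide
  rcases h with ⟨rfl | rfl, rfl | rfl⟩ <;> simp [chi2, h11]

/-- the parity sign of a vertex. -/
noncomputable def sgn2 {d : ℕ} (u : Fin d → ZMod 2) : ℝ := ∏ j, chi2 (u j)

lemma sgn2_add {d : ℕ} (u v : Fin d → ZMod 2) : sgn2 (u + v) = sgn2 u * sgn2 v := by
  simp [sgn2, chi2_add, Finset.prod_mul_distrib]

lemma sgn2_zero {d : ℕ} : sgn2 (0 : Fin d → ZMod 2) = 1 := by simp [sgn2, chi2]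

lemma sgn2_one {d : ℕ} : sgn2 (1 : Fin d → ZMod 2) = (-1) ^ d := by simp [sgn2, chi2]

lemma sgn2_single {d : ℕ} (j : Fin d) : sgn2 (Pi.single j 1 : Fin d → ZMod 2) = -1 := by
  unfold sgn2
  rw [Fintype.prod_eq_single j]
  · simp [chi2]
  · intro i hi
    simp [chi2, hi]

lemma sgn2_sq {d : ℕ} (u : Fin d → ZMod 2) : sgn2 u * sgn2 u = 1 := by
  rw [← sgn2_add, show u + u = 0 from funext fun i => CharTwo.add_self_eq_zero (u i), sgn2_zero]

/-- the diagonal sign matrix. -/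
noncomputable def Dg (d : ℕ) : Matrix (Fin d → ZMod 2) (Fin d → ZMod 2) ℝ :=
  Matrix.diagonal sgn2

lemma Dg_mul_Dg (d : ℕ) : Dg d * Dg d = 1 := by
  simp [Dg, Matrix.diagonal_mul_diagonal, sgn2_sq]

lemma Dg_single {d : ℕ} (u : Fin d → ZMod 2) :
    Dg d *ᵥ Pi.single u 1 = sgn2 u • Pi.single u (1 : ℝ) := by
  ext v
  by_cases h : v = u
  · subst h; simp [Dg, Matrix.mulVec_diagonal]
  · simp [Dg, Matrix.mulVec_diagonal, h]

lemma Hm_Dg (d m : ℕ) [NeZero d] : Hm d m * Dg d = -(Dg d * Hm d m) := by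
  ext u v
  have key : ∀ j : Fin d, u - v = Pi.single j 1 → sgn2 u = - sgn2 v := by
    intro j h
    have : u = Pi.single j 1 + v := by rw [← h]; simp
    rw [this, sgn2_add, sgn2_single]; ring
  simp only [Dg, Matrix.mul_diagonal, Matrix.neg_apply, Matrix.diagonal_mul, Hm, Matrix.of_apply]
  split_ifs with h1 h2
  · rw [key _ h1]; ring
  · obtain ⟨j, -, hj⟩ := h2
    rw [key _ hj]; ring
  · simp

lemma IsEigenprojR.unique {n : Type*} [Fintype n] [DecidableEq n] {M : Matrix n n ℝ} {μ : ℝ}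
    {E F : Matrix n n ℝ} (hE : IsEigenprojR M μ E) (hF : IsEigenprojR M μ F) : E = F := by
  have key : ∀ {A B : Matrix n n ℝ}, IsEigenprojR M μ A → IsEigenprojR M μ B → A * B = B := by
    intro A B hA hB
    refine Matrix.ext_of_mulVec_single fun i => ?_
    rw [← Matrix.mulVec_mulVec]
    apply hA.2.2.2
    rw [Matrix.mulVec_mulVec, hB.2.2.1, Matrix.smul_mulVec]
  have h1 := key hE hF
  have h2 := congrArg Matrix.conjTranspose (key hF hE)
  rw [Matrix.conjTranspose_mul, hE.1.eq, hF.1.eq] at h2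
  exact h2.symm.trans h1

lemma Dg_proj {d m : ℕ} [NeZero d] {lam : ℝ} {E : Matrix (Fin d → ZMod 2) (Fin d → ZMod 2) ℝ}
    (hE : IsEigenprojR (Hm d m) lam E) :
    IsEigenprojR (Hm d m) (-lam) (Dg d * E * Dg d) := by
  obtain ⟨h1, h2, h3, h4⟩ := hE
  have hD : (Dg d)ᴴ = Dg d := by simp [Dg]
  refine ⟨?_, ?_, ?_, ?_⟩
  · unfold Matrix.IsHermitian
    rw [Matrix.conjTranspose_mul, Matrix.conjTranspose_mul, hD, h1.eq, Matrix.mul_assoc]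
  · calc Dg d * E * Dg d * (Dg d * E * Dg d) = Dg d * E * (Dg d * Dg d) * E * Dg d := by
          simp only [Matrix.mul_assoc]
      _ = Dg d * (E * E) * Dg d := by
          rw [Dg_mul_Dg, Matrix.mul_one]; simp only [Matrix.mul_assoc]
      _ = _ := by rw [h2]
  · calc Hm d m * (Dg d * E * Dg d) = (Hm d m * Dg d) * E * Dg d := by
          simp only [Matrix.mul_assoc]
      _ = -(Dg d * (Hm d m * E) * Dg d) := by
          rw [Hm_Dg]; simp only [Matrix.mul_assoc, Matrix.neg_mul]
      _ = _ := by rw [h3]; simp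
  · intro v hv
    have : E *ᵥ (Dg d *ᵥ v) = Dg d *ᵥ v := by
      apply h4
      rw [Matrix.mulVec_mulVec, Hm_Dg, Matrix.neg_mulVec, ← Matrix.mulVec_mulVec, hv,
        Matrix.mulVec_smul]
      simp
    rw [← Matrix.mulVec_mulVec, ← Matrix.mulVec_mulVec, this, Matrix.mulVec_mulVec, Dg_mul_Dg,
      Matrix.one_mulVec]

lemma Dg_inj {d : ℕ} {v w : (Fin d → ZMod 2) → ℝ} : Dg d *ᵥ v = Dg d *ᵥ w ↔ v = w := by
  refine ⟨fun h => ?_, fun h => by rw [h]⟩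
  have := congrArg (fun x => Dg d *ᵥ x) h
  simpa [Matrix.mulVec_mulVec, Dg_mul_Dg] using this

/-- for `m` a positive odd integer and `a = (0,…,0)`, `b = (1,…,1)`:
if `d` is even then negation preserves the plus and minus sets, while if `d` is odd then
negation swaps them. -/
theorem stmt8 (d m : ℕ) [NeZero d] (hm : 0 < m) (hmodd : Odd m)
    (E : ℝ → Matrix (Fin d → ZMod 2) (Fin d → ZMod 2) ℝ)
    (hE : ∀ lam : ℝ, IsEigenprojR (Hm d m) lam (E lam)) :
    (Even d → ∀ lam : ℝ,
      (InPlusSet d E lam ↔ InPlusSet d E (-lam))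
        ∧ (InMinusSet d E lam ↔ InMinusSet d E (-lam)))
    ∧ (Odd d → ∀ lam : ℝ,
      (InPlusSet d E lam ↔ InMinusSet d E (-lam))
        ∧ (InMinusSet d E lam ↔ InPlusSet d E (-lam))) := by
  have hN : ∀ lam, E (-lam) = Dg d * E lam * Dg d := fun lam =>
    (hE (-lam)).unique (Dg_proj (hE lam))
  have h0 : ∀ lam, E (-lam) *ᵥ Pi.single (0 : Fin d → ZMod 2) 1
      = Dg d *ᵥ (E lam *ᵥ Pi.single (0 : Fin d → ZMod 2) 1) := by
    intro lam
    rw [hN, ← Matrix.mulVec_mulVec, ← Matrix.mulVec_mulVec, Dg_single, sgn2_zero, one_smul]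
  have h1 : ∀ lam, E (-lam) *ᵥ Pi.single (1 : Fin d → ZMod 2) 1
      = Dg d *ᵥ ((-1 : ℝ) ^ d • (E lam *ᵥ Pi.single (1 : Fin d → ZMod 2) 1)) := by
    intro lam
    rw [hN, ← Matrix.mulVec_mulVec, ← Matrix.mulVec_mulVec, Dg_single, sgn2_one,
      Matrix.mulVec_smul]
  have hz : ∀ v : (Fin d → ZMod 2) → ℝ, Dg d *ᵥ v = 0 ↔ v = 0 := fun v => by
    simpa using (Dg_inj (v := v) (w := 0))
  refine ⟨fun hd lam => ?_, fun hd lam => ?_⟩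
  · simp only [InPlusSet, InMinusSet, h0, h1, hd.neg_one_pow, one_smul, ← Matrix.mulVec_neg,
      Dg_inj, ne_eq, hz]
    exact ⟨trivial, trivial⟩
  · simp only [InPlusSet, InMinusSet, h0, h1, hd.neg_one_pow, neg_smul, one_smul,
      Matrix.mulVec_neg, neg_neg]
    have hn : ∀ v w : (Fin d → ZMod 2) → ℝ, Dg d *ᵥ v = -(Dg d *ᵥ w) ↔ v = -w := fun v w => by
      rw [← Matrix.mulVec_neg, Dg_inj]
    simp only [hn, Dg_inj, ne_eq, hz, and_self]
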